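/- Let l₁, l₂, l₃ be three distinct lines in Pic S₈ that pairwise intersect in 1. Then there exist lines l_a, l_b with l_a·l_b = 0 such that l₁ + l₂ + l₃ + K = l_a + l_b, the unordered pair {l_a, l_b} is unique, and moreover l_a·lᵢ = 0 and l_b·lᵢ = 0 for i = 1, 2, 3. -/

import Mathlib

/-!
Picard lattice of the degree 1 del Pezzo surface S₈:
Pic S₈ = ℤh ⊕ ℤe₁ ⊕ ⋯ ⊕ ℤe₈ ≅ ℤ⁹, with intersection pairing
h·h = 1, h·eᵢ = 0, eᵢ·eⱼ = −δᵢⱼ, and canonical class K = −3h + e₁ + ⋯ + e₈.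
-/

namespace DelPezzo

/-- The Picard lattice `Pic S₈ ≅ ℤ⁹`; coordinate `0` is the `h`-coordinate and
coordinates `1,…,8` are the `e₁,…,e₈`-coordinates. -/
abbrev Pic : Type := Fin 9 → ℤ

/-- The intersection pairing on `Pic S₈` (signature `(1,-8)`). -/
def inter (x y : Pic) : ℤ := x 0 * y 0 - ∑ i : Fin 8, x i.succ * y i.succ

/-- The canonical class `K = -3h + e₁ + ⋯ + e₈`. -/
def K : Pic := fun i => if i = 0 then -3 else 1

/-- A line: a class `l` with `l·l = -1` and `l·K = -1`. -/
def IsLine (l : Pic) : Prop := inter l l = -1 ∧ inter l K = -1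

lemma inter_comm (x y : Pic) : inter x y = inter y x := by
  simp only [inter, mul_comm]

lemma inter_add_left (x y z : Pic) : inter (x + y) z = inter x z + inter y z := by
  simp only [inter, Pi.add_apply, add_mul, Finset.sum_add_distrib]
  ring

lemma inter_smul_left (c : ℤ) (x z : Pic) : inter (c • x) z = c * inter x z := by
  simp only [inter, Pi.smul_apply, smul_eq_mul, mul_sub, Finset.mul_sum, mul_assoc]

lemma inter_add_right (x y z : Pic) : inter z (x + y) = inter z x + inter z y := by
  rw [inter_comm, inter_add_left, inter_comm x, inter_comm y]

lemma inter_smul_right (c : ℤ) (x z : Pic) : inter z (c • x) = c * inter z x := by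
  rw [inter_comm, inter_smul_left, inter_comm x]

lemma inter_sub_left (x y z : Pic) : inter (x - y) z = inter x z - inter y z := by
  have h := inter_add_left (x - y) y z
  rw [sub_add_cancel] at h
  linarith

lemma inter_sub_right (x y z : Pic) : inter z (x - y) = inter z x - inter z y := by
  rw [inter_comm, inter_sub_left, inter_comm x, inter_comm y]

lemma inter_K (x : Pic) : inter x K = -3 * x 0 - ∑ i : Fin 8, x i.succ := by
  simp [inter, K, Fin.succ_ne_zero]
  ring

lemma inter_K_K : inter K K = 1 := by decide

/-- The pairing is negative definite on the orthogonal complement of `K`. -/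
lemma eq_zero_of_inter_self_nonneg {x : Pic} (hK : inter x K = 0) (h : 0 ≤ inter x x) :
    x = 0 := by
  rw [inter_K] at hK
  have hcs : (∑ i : Fin 8, x i.succ) ^ 2 ≤ 8 * ∑ i : Fin 8, x i.succ ^ 2 := by
    simpa using sq_sum_le_card_mul_sum_sq (s := Finset.univ) (f := fun i : Fin 8 => x i.succ)
  simp only [inter, ← pow_two] at h
  have hs : ∑ i : Fin 8, x i.succ = -3 * x 0 := by linarith
  rw [hs] at hcs
  have h0 : x 0 = 0 := by
    have : x 0 ^ 2 = 0 := le_antisymm (by linarith) (sq_nonneg _)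
    simpa using this
  have hz : ∑ i : Fin 8, x i.succ ^ 2 = 0 :=
    le_antisymm (by simpa [h0] using h) (Finset.sum_nonneg fun _ _ => sq_nonneg _)
  rw [Finset.sum_eq_zero_iff_of_nonneg fun _ _ => sq_nonneg _] at hz
  funext i
  refine Fin.cases h0 (fun j => ?_) i
  simpa using hz j (Finset.mem_univ j)

/-- By Riemann–Roch, `x·x` and `x·K` have the same parity. -/
lemma even_inter_self_add_inter_K (x : Pic) : Even (inter x x + inter x K) := by
  have hs : inter x x + inter x K
      = x 0 * (x 0 + 1) - 4 * x 0 - ∑ i : Fin 8, x i.succ * (x i.succ + 1) := by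
    rw [inter_K]
    simp only [inter, mul_add, mul_one, Finset.sum_add_distrib]
    ring
  rw [hs]
  exact ((Int.even_mul_succ_self _).sub (by simp [show Even (4 : ℤ) by decide])).sub
    (Finset.even_sum _ fun i _ => Int.even_mul_succ_self _)

/-- Distinct lines have nonnegative intersection. -/
lemma IsLine.eq_of_inter_neg {l m : Pic} (hl : IsLine l) (hm : IsLine m) (h : inter l m < 0) :
    l = m := by
  rw [← sub_eq_zero]
  apply eq_zero_of_inter_self_nonneg
  · rw [inter_sub_left, hl.2, hm.2, sub_self]
  · rw [inter_sub_left, inter_sub_right, inter_sub_right, hl.1, hm.1, inter_comm m]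
    linarith

/-- The class `a h - ∑ pᵢ eᵢ + 2 c eⱼ` is a root when its degree and self-intersection are right. -/
lemma exists_root_of_parity (p : Fin 8 → ℤ) (hp : ∀ i, p i = 0 ∨ p i = 1) (a c : ℤ) (j : Fin 8)
    (hK : ∑ i, p i = 3 * a + 2 * c) (hsq : a ^ 2 - ∑ i, p i + 4 * c * p j - 4 * c ^ 2 = -2) :
    ∃ w : Pic, inter w w = -2 ∧ inter w K = 0 ∧ w 0 = a ∧
      ∀ i : Fin 8, ∃ t, w i.succ + p i = 2 * t := by
  have hpp : ∀ i, p i * p i = p i := fun i => by rcases hp i with h | h <;> simp [h]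
  let w : Pic := Fin.cons a fun i => -p i + 2 * c * (if i = j then 1 else 0)
  refine ⟨w, ?_, ?_, rfl, fun i => ⟨c * (if i = j then 1 else 0), ?_⟩⟩
  · have hi : ∀ i, (-p i + 2 * c * (if i = j then 1 else 0)) *
        (-p i + 2 * c * (if i = j then 1 else 0))
        = p i + (if i = j then 4 * c ^ 2 - 4 * c * p i else 0) := by
      intro i
      split_ifs <;> linear_combination hpp i
    simp only [inter, w, Fin.cons_zero, Fin.cons_succ, hi, Finset.sum_add_distrib,
      Finset.sum_ite_eq', Finset.mem_univ, if_true]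
    linarith
  · simp only [inter_K, w, Fin.cons_zero, Fin.cons_succ, Finset.sum_add_distrib,
      Finset.sum_neg_distrib, ← Finset.mul_sum, Finset.sum_ite_eq', Finset.mem_univ, if_true]
    linarith
  · simp only [w, Fin.cons_succ]
    ring

/-- A class with `v·v = v·K = -2` is congruent to a root modulo `2`. -/
lemma exists_root_add_eq_two_smul {v : Pic} (hsq : inter v v = -2) (hK : inter v K = -2) :
    ∃ w u : Pic, inter w w = -2 ∧ inter w K = 0 ∧ v + w = (2 : ℤ) • u := by
  let p : Fin 8 → ℤ := fun i => v i.succ % 2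
  let q : Fin 8 → ℤ := fun i => v i.succ / 2
  have hp : ∀ i, p i = 0 ∨ p i = 1 := fun i => Int.emod_two_eq_zero_or_one _
  have hv : ∀ i : Fin 8, v i.succ = 2 * q i + p i := fun i => (Int.mul_ediv_add_emod _ 2).symm
  have hlin : ∑ i : Fin 8, v i.succ = 2 * ∑ i, q i + ∑ i, p i := by
    simp only [hv, Finset.sum_add_distrib, Finset.mul_sum]
  have hquad : ∑ i : Fin 8, v i.succ * v i.succ = 4 * ∑ i, (q i ^ 2 + q i * p i) + ∑ i, p i := by
    rw [Finset.mul_sum, ← Finset.sum_add_distrib]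
    refine Finset.sum_congr rfl fun i _ => ?_
    rw [hv]
    rcases hp i with h | h <;> rw [h] <;> ring
  rw [inter_K, hlin] at hK
  rw [inter, hquad] at hsq
  have hn0 : 0 ≤ ∑ i, p i := Finset.sum_nonneg fun i _ => by rcases hp i with h | h <;> simp [h]
  have hn8 : ∑ i, p i ≤ 8 := by
    have := Finset.sum_le_sum (s := Finset.univ) (f := p) (g := fun _ => 1)
      fun i _ => by rcases hp i with h | h <;> simp [h]
    simpa using this
  suffices H : ∃ (a c : ℤ) (j : Fin 8), (∃ s, v 0 + a = 2 * s) ∧ ∑ i, p i = 3 * a + 2 * c ∧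
      a ^ 2 - ∑ i, p i + 4 * c * p j - 4 * c ^ 2 = -2 by
    obtain ⟨a, c, j, ⟨s, hs⟩, h₁, h₂⟩ := H
    obtain ⟨w, hww, hwK, hw0, hw⟩ := exists_root_of_parity p hp a c j h₁ h₂
    choose t ht using hw
    refine ⟨w, Fin.cons s fun i => q i + t i, hww, hwK, ?_⟩
    funext i
    refine Fin.cases ?_ (fun i => ?_) i
    · simp [hw0, hs]
    · simp only [Pi.add_apply, Pi.smul_apply, Fin.cons_succ, smul_eq_mul]
      linarith [hv i, ht i]
  generalize hQ : ∑ i, q i = Q at hK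
  generalize ∑ i, (q i ^ 2 + q i * p i) = X at hsq
  have hcases : (∑ i, p i = 2 ∧ v 0 % 2 = 0) ∨ (∑ i, p i = 3 ∧ v 0 % 2 = 1) ∨
      (∑ i, p i = 6 ∧ v 0 % 2 = 0) ∨ (∑ i, p i = 7 ∧ v 0 % 2 = 1) := by
    rcases Int.even_or_odd' (v 0) with ⟨k, h | h⟩
    · have : v 0 * v 0 = 4 * (k * k) := by rw [h]; ring
      omega
    · have : v 0 * v 0 = 4 * (k * k + k) + 1 := by rw [h]; ring
      omega
  rcases hcases with ⟨hn, h0⟩ | ⟨hn, h0⟩ | ⟨hn, h0⟩ | ⟨hn, h0⟩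
  · obtain ⟨j, hj⟩ : ∃ j, p j = 1 := by
      by_contra! hne
      have : ∑ i, p i = 0 := Finset.sum_eq_zero fun i _ => (hp i).resolve_right (hne i)
      omega
    exact ⟨0, 1, j, ⟨v 0 / 2, by omega⟩, by omega, by rw [hn, hj]; norm_num⟩
  · exact ⟨1, 0, 0, ⟨v 0 / 2 + 1, by omega⟩, by omega, by rw [hn]; norm_num⟩
  · exact ⟨2, 0, 0, ⟨v 0 / 2 + 1, by omega⟩, by omega, by rw [hn]; norm_num⟩
  · obtain ⟨j, hj⟩ : ∃ j, p j = 0 := by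
      by_contra! hne
      have : ∑ i, p i = ∑ _i : Fin 8, (1 : ℤ) :=
        Finset.sum_congr rfl fun i _ => (hp i).resolve_left (hne i)
      simp at this
      omega
    exact ⟨3, -1, j, ⟨v 0 / 2 + 2, by omega⟩, by omega, by rw [hn, hj]; norm_num⟩

/-- A class with `v·v = v·K = -2` is a sum of two skew lines. -/
lemma exists_skew_lines_of_inter {v : Pic} (hsq : inter v v = -2) (hK : inter v K = -2) :
    ∃ la lb : Pic, IsLine la ∧ IsLine lb ∧ inter la lb = 0 ∧ v = la + lb := by
  obtain ⟨w, u, hww, hwK, hu⟩ := exists_root_add_eq_two_smul hsq hK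
  have hv : v = (2 : ℤ) • u - w := by rw [← hu, add_sub_cancel_right]
  have hvw : inter v w = 0 := by
    have huu := congrArg (fun x => inter x x) hu
    have huK := congrArg (fun x => inter x K) hu
    simp only [inter_add_left, inter_add_right, inter_smul_left, inter_smul_right,
      inter_comm w v] at huu huK
    obtain ⟨k, hk⟩ := even_inter_self_add_inter_K u
    have hpos (s : ℤ) (hs : s * s = 1) : 4 * (s * inter v w) < 16 := by
      by_contra! hge
      have hz : v + (2 : ℤ) • K + s • w = 0 := by
        apply eq_zero_of_inter_self_nonneg
        · simp only [inter_add_left, inter_smul_left, inter_K_K, hwK, hK]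
          ring
        · simp only [inter_add_left, inter_add_right, inter_smul_left, inter_smul_right,
            inter_K_K, hwK, hK, inter_comm K, inter_comm w v, hww, hsq]
          linarith
      have := congrArg (fun x => inter x (v + (2 : ℤ) • K - s • w)) hz
      simp only [inter_add_left, inter_add_right, inter_sub_right, inter_smul_left,
        inter_smul_right, inter_K_K, hwK, hK, inter_comm K, inter_comm w v, hww, hsq] at this
      simp [inter] at this
      linarith
    have h₁ := hpos 1 (by norm_num)
    have h₂ := hpos (-1) (by norm_num)
    omega
  refine ⟨u, u - w, ?_⟩
  have huK := congrArg (fun x => inter x K) hu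
  have huw := congrArg (fun x => inter x w) hu
  have huu := congrArg (fun x => inter x x) hu
  simp only [inter_add_left, inter_add_right, inter_smul_left, inter_smul_right,
    inter_comm w v] at huK huw huu
  simp only [IsLine, inter_sub_left, inter_sub_right, inter_comm w u]
  refine ⟨⟨?_, ?_⟩, ⟨?_, ?_⟩, ?_, ?_⟩ <;> first | linarith | skip
  rw [hv, two_smul]
  abel

/-- Decompositions as a sum of two skew lines are unique. -/
lemma pair_eq_of_add_eq {la lb ma mb : Pic} (hla : IsLine la) (hlb : IsLine lb)
    (hma : IsLine ma) (hm : inter ma mb = 0) (h : la + lb = ma + mb) :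
    ({ma, mb} : Set Pic) = {la, lb} := by
  have hsum := congrArg (inter ma) h
  rw [inter_add_right, inter_add_right, hma.1, hm] at hsum
  rcases lt_or_ge (inter ma la) 0 with hneg | hnn
  · obtain rfl := hma.eq_of_inter_neg hla hneg
    rw [add_left_cancel h]
  · obtain rfl := hma.eq_of_inter_neg hlb (by linarith)
    rw [add_comm] at h
    rw [add_left_cancel h, Set.pair_comm]

/-- A line `m` with `m·(l₁ + l₂ + l₃) = 0` is skew to each line of the triangle `l₁, l₂, l₃`. -/
lemma IsLine.inter_triangle_eq_zero {l₁ l₂ l₃ m : Pic} (hm : IsLine m)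
    (h₁ : IsLine l₁) (h₂ : IsLine l₂) (h₃ : IsLine l₃)
    (h₁₂ : inter l₁ l₂ = 1) (h₁₃ : inter l₁ l₃ = 1) (h₂₃ : inter l₂ l₃ = 1)
    (hsum : inter m l₁ + inter m l₂ + inter m l₃ = 0) :
    inter m l₁ = 0 ∧ inter m l₂ = 0 ∧ inter m l₃ = 0 := by
  have n₁ : 0 ≤ inter m l₁ := by
    by_contra! hneg
    obtain rfl := hm.eq_of_inter_neg h₁ hneg
    linarith [hm.1]
  have n₂ : 0 ≤ inter m l₂ := by
    by_contra! hneg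
    obtain rfl := hm.eq_of_inter_neg h₂ hneg
    linarith [hm.1, inter_comm l₁ m]
  have n₃ : 0 ≤ inter m l₃ := by
    by_contra! hneg
    obtain rfl := hm.eq_of_inter_neg h₃ hneg
    linarith [hm.1, inter_comm l₁ m, inter_comm l₂ m]
  refine ⟨?_, ?_, ?_⟩ <;> linarith

theorem triangle_gives_unique_skew_pair (l₁ l₂ l₃ : Pic)
    (h₁ : IsLine l₁) (h₂ : IsLine l₂) (h₃ : IsLine l₃)
    (hne₁₂ : l₁ ≠ l₂) (hne₁₃ : l₁ ≠ l₃) (hne₂₃ : l₂ ≠ l₃)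
    (h₁₂ : inter l₁ l₂ = 1) (h₁₃ : inter l₁ l₃ = 1) (h₂₃ : inter l₂ l₃ = 1) :
    ∃ la lb : Pic, IsLine la ∧ IsLine lb ∧ inter la lb = 0 ∧
      l₁ + l₂ + l₃ + K = la + lb ∧
      (∀ la' lb' : Pic, IsLine la' → IsLine lb' → inter la' lb' = 0 →
        l₁ + l₂ + l₃ + K = la' + lb' → ({la', lb'} : Set Pic) = {la, lb}) ∧
      inter la l₁ = 0 ∧ inter la l₂ = 0 ∧ inter la l₃ = 0 ∧
      inter lb l₁ = 0 ∧ inter lb l₂ = 0 ∧ inter lb l₃ = 0 := by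
  have hsq : inter (l₁ + l₂ + l₃ + K) (l₁ + l₂ + l₃ + K) = -2 := by
    simp only [inter_add_left, inter_add_right, inter_comm K, inter_comm l₂ l₁, inter_comm l₃ l₁,
      inter_comm l₃ l₂, inter_K_K, h₁.1, h₁.2, h₂.1, h₂.2, h₃.1, h₃.2, h₁₂, h₁₃, h₂₃]
    norm_num
  have hK : inter (l₁ + l₂ + l₃ + K) K = -2 := by
    simp only [inter_add_left, inter_K_K, h₁.2, h₂.2, h₃.2]
    norm_num
  obtain ⟨la, lb, hla, hlb, hab, hv⟩ := exists_skew_lines_of_inter hsq hK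
  have ha := congrArg (inter la) hv
  have hb := congrArg (inter lb) hv
  simp only [inter_add_right, inter_comm lb la, hla.1, hla.2, hlb.1, hlb.2, hab] at ha hb
  obtain ⟨a₁, a₂, a₃⟩ :=
    hla.inter_triangle_eq_zero h₁ h₂ h₃ h₁₂ h₁₃ h₂₃ (by linarith)
  obtain ⟨b₁, b₂, b₃⟩ :=
    hlb.inter_triangle_eq_zero h₁ h₂ h₃ h₁₂ h₁₃ h₂₃ (by linarith)
  exact ⟨la, lb, hla, hlb, hab, hv,
    fun _ _ hma _ hm h => pair_eq_of_add_eq hla hlb hma hm (hv.symm.trans h),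
    a₁, a₂, a₃, b₁, b₂, b₃⟩

end DelPezzo
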